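/- arXiv:1204.2398 — 2 statements merged into one kernel-verified Lean document; each statement's English description precedes it below -/
import Mathlib

section
/- Let L be a Lie algebra over a field K, let h ∈ L, and suppose x = x₁ + x₂ + ⋯ + xₙ where for each i one has ⁅h, xᵢ⁆ = λᵢ • xᵢ with scalars λ₁, …, λₙ ∈ K that are pairwise distinct. Then every xᵢ lies in the Lie subalgebra of L generated by the two-element set {h, x}. -/
/-- If a submodule `p` is invariant under `f` and contains a sum of eigenvectors of `f` with
pairwise distinct eigenvalues, then it contains each of these eigenvectors. -/
theorem Submodule.mem_of_sum_eigenvectors_mem {K V ι : Type*} [Field K] [AddCommGroup V]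
    [Module K V] {f : Module.End K V} {p : Submodule K V} (hp : ∀ v ∈ p, f v ∈ p)
    {lam : ι → K} {s : Finset ι} (hlam : Set.InjOn lam s) {x : ι → V}
    (hx : ∀ i ∈ s, f (x i) = lam i • x i) (hsum : ∑ i ∈ s, x i ∈ p) :
    ∀ i ∈ s, x i ∈ p := by
  classical
  induction s using Finset.induction_on generalizing x with
  | empty => simp
  | insert a s ha ih =>
    have hdiff : ∑ i ∈ s, (lam i - lam a) • x i ∈ p := by
      have hmem := p.sub_mem (hp _ hsum) (p.smul_mem (lam a) hsum)
      rwa [map_sum, Finset.smul_sum, ← Finset.sum_sub_distrib,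
        Finset.sum_congr rfl fun i hi => by rw [hx i hi, ← sub_smul],
        Finset.sum_insert ha, sub_self, zero_smul, zero_add] at hmem
    have hs : ∀ i ∈ s, x i ∈ p := by
      intro i hi
      have hne : lam i - lam a ≠ 0 := fun h =>
        ha (hlam (by simp [hi]) (by simp) (sub_eq_zero.mp h) ▸ hi)
      refine (p.smul_mem_iff hne).mp (ih (hlam.mono (by simp)) (fun j hj => ?_) hdiff i hi)
      rw [map_smul, hx j (Finset.mem_insert_of_mem hj), smul_comm]
    intro i hi
    rcases Finset.mem_insert.mp hi with rfl | hi
    · rw [Finset.sum_insert ha] at hsum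
      exact (p.add_mem_iff_left (p.sum_mem hs)).mp hsum
    · exact hs i hi


/-- Let `L` be a Lie algebra over a field `K`, `h ∈ L`, and suppose
`x = x₁ + ⋯ + xₙ` where `⁅h, xᵢ⁆ = λᵢ • xᵢ` with pairwise distinct scalars `λᵢ`.
Then every `xᵢ` lies in the Lie subalgebra of `L` generated by `{h, x}`. -/
theorem eigencomponents_mem_lieSpan
    {K L : Type*} [Field K] [LieRing L] [LieAlgebra K L]
    (h : L) (n : ℕ) (x : Fin n → L) (lam : Fin n → K)
    (heig : ∀ i, ⁅h, x i⁆ = lam i • x i)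
    (hdist : Function.Injective lam) :
    ∀ i, x i ∈ LieSubalgebra.lieSpan K L ({h, ∑ i, x i} : Set L) := by
  set S := LieSubalgebra.lieSpan K L ({h, ∑ i, x i} : Set L)
  have hh : h ∈ S := LieSubalgebra.subset_lieSpan (by simp)
  have hsum : ∑ i, x i ∈ S := LieSubalgebra.subset_lieSpan (by simp)
  exact fun i => Submodule.mem_of_sum_eigenvectors_mem (f := LieAlgebra.ad K L h)
    (p := S.toSubmodule) (fun v hv => S.lie_mem hh hv) hdist.injOn (fun j _ => heig j) hsum i
    (Finset.mem_univ i)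
end

section
/- Let 𝔤 be a finite-dimensional simple Lie algebra over an algebraically closed field K of characteristic zero, and let x be a nonzero element of 𝔤. Then there exists a Cartan subalgebra 𝔥 of 𝔤 such that x is 𝔥-balanced: writing x = x_0 + Σ_{α ∈ Φ} x^α for the decomposition of x with respect to the root space decomposition 𝔤 = 𝔥 ⊕ ⨁_{α ∈ Φ} 𝔤^α relative to 𝔥 (where Φ ⊆ 𝔥* is the set of nonzero roots), one has x^α ≠ 0 for every α ∈ Φ. Equivalently, for every nonzero root α of 𝔤 relative to 𝔥, the element x does not lie in the sum of 𝔥 and the root spaces 𝔤^β over all roots β ≠ α. -/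
open LieAlgebra

section PolynomialFamily

variable {K V : Type*} [Field K] [AddCommGroup V] [Module K V]

/-- A one-parameter family of linear endomorphisms is polynomial if all its matrix coefficients
are polynomial functions of the parameter. -/
def IsPolynomialFamily (φ : K → Module.End K V) : Prop :=
  ∀ (f : Module.Dual K V) (y : V), ∃ p : Polynomial K, ∀ t, f (φ t y) = p.eval t

lemma IsPolynomialFamily.mul [FiniteDimensional K V] {φ ψ : K → Module.End K V}
    (hφ : IsPolynomialFamily φ) (hψ : IsPolynomialFamily ψ) :
    IsPolynomialFamily (φ * ψ) := by
  intro f y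
  let b := Module.finBasis K V
  choose p hp using fun i ↦ hφ f (b i)
  choose q hq using fun i ↦ hψ (b.coord i) y
  refine ⟨∑ i, q i * p i, fun t ↦ ?_⟩
  have h : ψ t y = ∑ i, b.coord i (ψ t y) • b i := (b.sum_repr _).symm
  calc f (φ t (ψ t y)) = f (φ t (∑ i, b.coord i (ψ t y) • b i)) := congrArg (f ∘ φ t) h
    _ = _ := by simp only [map_sum, map_smul, smul_eq_mul, hp, hq, Polynomial.eval_finsetSum,
      Polynomial.eval_mul]

lemma isPolynomialFamily_sum_pow (A : ℕ → Module.End K V) (n : ℕ) :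
    IsPolynomialFamily fun t : K ↦ ∑ i ∈ Finset.range n, t ^ i • A i := by
  intro f y
  refine ⟨∑ i ∈ Finset.range n, Polynomial.C (f (A i y)) * Polynomial.X ^ i, fun t ↦ ?_⟩
  simp only [LinearMap.sum_apply, LinearMap.smul_apply, map_sum, map_smul, smul_eq_mul,
    Polynomial.eval_finsetSum, Polynomial.eval_mul, Polynomial.eval_C, Polynomial.eval_pow,
    Polynomial.eval_X, mul_comm]

/-- If a polynomial curve `∑ tⁱ vᵢ` in a vector space over an infinite field stays inside a
subspace, then so do its coefficients. -/
lemma Submodule.mem_of_forall_sum_pow_smul_mem [Infinite K] (S : Submodule K V) (v : ℕ → V)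
    (n : ℕ) (h : ∀ t : K, ∑ i ∈ Finset.range n, t ^ i • v i ∈ S) {j : ℕ} (hj : j < n) :
    v j ∈ S := by
  by_contra hv
  obtain ⟨f, hf, hfS⟩ := Submodule.exists_le_ker_of_notMem hv
  let p : Polynomial K := ∑ i ∈ Finset.range n, Polynomial.C (f (v i)) * Polynomial.X ^ i
  have hp : p = 0 := Polynomial.funext fun t ↦ by
    have := hfS (h t)
    rw [LinearMap.mem_ker] at this
    simpa only [p, map_sum, map_smul, smul_eq_mul, Polynomial.eval_finsetSum, Polynomial.eval_mul,
      Polynomial.eval_C, Polynomial.eval_pow, Polynomial.eval_X, mul_comm, Polynomial.eval_zero]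
      using this
  have := congrArg (fun q ↦ Polynomial.coeff q j) hp
  simp [p, Polynomial.coeff_X_pow, hj] at this
  exact hf this

end PolynomialFamily

section

variable {K L : Type*} [Field K] [CharZero K] [LieRing L] [LieAlgebra K L]

/-- The one-parameter family of automorphisms `exp (t • ad e)` for an ad-nilpotent element `e`. -/
lemma LieAlgebra.exists_lieEquiv_eq_exp_smul_ad {e : L} (he : IsNilpotent (ad K L e)) :
    ∃ (n : ℕ) (φ : K → (L ≃ₗ⁅K⁆ L)), 1 < n ∧ ∀ t y,
      φ t y = ∑ i ∈ Finset.range n, t ^ i • (i.factorial : K)⁻¹ • (ad K L e ^ i) y := by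
  obtain ⟨k, hk⟩ := he
  let _ : Module ℚ L := Module.compHom L (algebraMap ℚ K)
  have hQ (q : ℚ) (y : L) : q • y = (q : K) • y := rfl
  let _ : LieAlgebra ℚ L := { lie_smul := fun q y z ↦ by simp [hQ] }
  have hk' : ad K L e ^ (k + 2) = 0 := by rw [pow_add, hk, zero_mul]
  have hD (t : K) : (LieDerivation.ad K L (t • e)).toLinearMap = t • ad K L e := by
    ext y; simp
  have hn (t : K) : (LieDerivation.ad K L (t • e)).toLinearMap ^ (k + 2) = 0 := by
    rw [hD, smul_pow, hk', smul_zero]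
  refine ⟨k + 2, fun t ↦ LieDerivation.exp (LieDerivation.ad K L (t • e)) ⟨_, hn t⟩,
    by omega, fun t y ↦ ?_⟩
  refine (LieDerivation.exp_map_apply _ ⟨_, hn t⟩ y).trans ?_
  rw [IsNilpotent.exp_eq_sum (hn t), LinearMap.sum_apply]
  refine Finset.sum_congr rfl fun i _ ↦ ?_
  rw [hD, smul_pow, LinearMap.smul_apply, hQ, LinearMap.smul_apply, smul_comm]
  simp

variable [IsAlgClosed K] [FiniteDimensional K L]

/-- A subspace of a semisimple Lie algebra that is stable under all ad-nilpotent elements is an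
ideal. -/
lemma LieAlgebra.lie_mem_of_forall_isNilpotent_ad [IsKilling K L] (S : Submodule K L)
    (h : ∀ e : L, IsNilpotent (ad K L e) → ∀ w ∈ S, ⁅e, w⁆ ∈ S) (z : L) {w : L} (hw : w ∈ S) :
    ⁅z, w⁆ ∈ S := by
  obtain ⟨a, ha⟩ := exists_isCartanSubalgebra_engel K L
  set H := LieSubalgebra.engel K a
  let T : LieSubalgebra K L :=
    { carrier := {z | ∀ w ∈ S, ⁅z, w⁆ ∈ S}
      add_mem' := fun hx hy w hw ↦ by
        rw [add_lie]; exact S.add_mem (hx w hw) (hy w hw)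
      zero_mem' := fun w _ ↦ by simp
      smul_mem' := fun c z hz w hw ↦ by
        rw [smul_lie]; exact S.smul_mem c (hz w hw)
      lie_mem' := fun {x y} hx hy w hw ↦ by
        rw [lie_lie]; exact S.sub_mem (hx _ (hy w hw)) (hy _ (hx w hw)) }
  have hroot (χ : H → K) (hχ : χ ≠ 0) (e : L) (he : e ∈ rootSpace H χ) : e ∈ T :=
    h e (isNilpotent_ad_of_mem_rootSpace H hχ he)
  have hcoroot (α : LieModule.Weight K H L) (hα : α.IsNonZero) :
      (IsKilling.corootSubmodule α).toSubmodule ≤ T.toSubmodule := by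
    rintro _ ⟨y, hy, rfl⟩
    have hα' : (α : H → K) ≠ 0 := hα
    refine Submodule.span_le.mpr ?_ ((mem_corootSpace _).mp hy)
    rintro _ ⟨u, hu, v, hv, rfl⟩
    exact T.lie_mem (hroot _ hα' u hu) (hroot _ (neg_ne_zero.mpr hα') v hv)
  have hH : H.toSubmodule ≤ T.toSubmodule := by
    have := congrArg LieSubmodule.toSubmodule (IsKilling.biSup_corootSubmodule_eq_cartan H)
    simp only [LieSubmodule.iSup_toSubmodule] at this
    rw [LieSubalgebra.coe_toLieSubmodule] at this
    rw [← this]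
    exact iSup₂_le hcoroot
  have htop : (⊤ : Submodule K L) ≤ T.toSubmodule := by
    have := congrArg LieSubmodule.toSubmodule (cartan_sup_iSup_rootSpace_eq_top (K := K) H)
    simp only [LieSubmodule.iSup_toSubmodule, LieSubmodule.sup_toSubmodule,
      LieSubmodule.top_toSubmodule] at this
    rw [← this]
    exact sup_le hH (iSup₂_le fun α hα ↦ hroot α hα)
  exact htop (Submodule.mem_top (x := z)) w hw

variable [LieAlgebra.IsSimple K L]

/-- In a simple Lie algebra, every nonzero element can be moved out of any given proper subspace
along a polynomial family of automorphisms starting at the identity. -/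
lemma LieAlgebra.exists_isPolynomialFamily_apply_notMem {y : L} (hy : y ≠ 0)
    {W : Submodule K L} (hW : W ≠ ⊤) :
    ∃ φ : K → (L ≃ₗ⁅K⁆ L), IsPolynomialFamily (fun t ↦ ((φ t : L →ₗ⁅K⁆ L) : Module.End K L)) ∧
      φ 0 = LieEquiv.refl ∧ φ 1 y ∉ W := by
  by_contra! hcon
  let P (φ : K → (L ≃ₗ⁅K⁆ L)) : Prop :=
    IsPolynomialFamily (fun t ↦ ((φ t : L →ₗ⁅K⁆ L) : Module.End K L)) ∧ φ 0 = LieEquiv.refl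
  let S : Submodule K L := Submodule.span K {z | ∃ φ, P φ ∧ φ 1 y = z}
  have hyS : y ∈ S := by
    refine Submodule.subset_span ⟨fun _ ↦ LieEquiv.refl, ⟨fun f z ↦ ?_, rfl⟩, rfl⟩
    exact ⟨Polynomial.C (f z), fun t ↦ by simp⟩
  have hSW : S ≤ W := Submodule.span_le.mpr (by
    rintro _ ⟨φ, hφ, rfl⟩
    exact hcon φ hφ.1 hφ.2)
  have hS (ψ : K → (L ≃ₗ⁅K⁆ L)) (hψ : P ψ) : S ≤ S.comap (ψ 1 : L →ₗ⁅K⁆ L).toLinearMap := by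
    refine Submodule.span_le.mpr ?_
    rintro _ ⟨φ, hφ, rfl⟩
    refine Submodule.subset_span ⟨fun t ↦ (φ t).trans (ψ t), ⟨?_, ?_⟩, rfl⟩
    · exact hψ.1.mul hφ.1
    · simp only [hφ.2, hψ.2]; rfl
  have hstab (e : L) (he : IsNilpotent (ad K L e)) (w : L) (hw : w ∈ S) : ⁅e, w⁆ ∈ S := by
    obtain ⟨n, φ, hn, hφ⟩ := exists_lieEquiv_eq_exp_smul_ad he
    have hφ' (c t : K) : ((φ (c * t) : L →ₗ⁅K⁆ L) : Module.End K L) =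
        ∑ i ∈ Finset.range n, t ^ i • c ^ i • (i.factorial : K)⁻¹ • ad K L e ^ i := by
      ext z
      refine (hφ _ z).trans ?_
      simp only [LinearMap.sum_apply, LinearMap.smul_apply]
      refine Finset.sum_congr rfl fun i _ ↦ ?_
      rw [smul_smul (t ^ i), mul_pow, mul_comm]
    have hP (c : K) : P fun t ↦ φ (c * t) := by
      refine ⟨?_, ?_⟩
      · simp only [hφ']
        exact isPolynomialFamily_sum_pow _ n
      · ext z
        obtain ⟨m, rfl⟩ : ∃ m, n = m + 1 := ⟨n - 1, by omega⟩
        simp [hφ, Finset.sum_range_succ']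
    have := S.mem_of_forall_sum_pow_smul_mem
      (fun i ↦ (i.factorial : K)⁻¹ • (ad K L e ^ i) w) n (fun t ↦ by
        rw [← hφ, ← mul_one t]
        exact hS _ (hP t) hw) hn
    simpa using this
  let I : LieIdeal K L := { S with lie_mem := fun {z w} hw ↦
    lie_mem_of_forall_isNilpotent_ad S hstab z hw }
  have hIS : I.toSubmodule = S := rfl
  rcases IsSimple.eq_bot_or_eq_top I with hI | hI
  · rw [hI] at hIS
    rw [← hIS] at hyS
    exact hy (by simpa using hyS)
  · rw [hI] at hIS
    exact hW (top_le_iff.mp (hIS.trans_le hSW))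

/-- In a simple Lie algebra, every nonzero element can be moved by an automorphism out of finitely
many given proper subspaces simultaneously. -/
lemma LieAlgebra.exists_lieEquiv_forall_apply_notMem {ι : Type*} (s : Finset ι)
    (W : ι → Submodule K L) (hW : ∀ i ∈ s, W i ≠ ⊤) {x : L} (hx : x ≠ 0) :
    ∃ g : L ≃ₗ⁅K⁆ L, ∀ i ∈ s, g x ∉ W i := by
  classical
  induction s using Finset.induction_on with
  | empty => exact ⟨LieEquiv.refl, by simp⟩
  | insert a s _ ih =>
    obtain ⟨g, hg⟩ := ih fun i hi ↦ hW i (Finset.mem_insert_of_mem hi)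
    obtain ⟨φ, hφ, hφ0, hφ1⟩ := exists_isPolynomialFamily_apply_notMem
      (y := g x) (by simpa using hx) (hW a (Finset.mem_insert_self a s))
    have key (i : ι) (hi : i ∈ insert a s) :
        ∃ p : Polynomial K, p ≠ 0 ∧ ∀ t, φ t (g x) ∈ W i → p.eval t = 0 := by
      obtain ⟨t₀, ht₀⟩ : ∃ t₀, φ t₀ (g x) ∉ W i := by
        rcases Finset.mem_insert.mp hi with rfl | hi
        · exact ⟨1, hφ1⟩
        · exact ⟨0, by simpa [hφ0] using hg i hi⟩
      obtain ⟨f, hf, hfW⟩ := Submodule.exists_le_ker_of_notMem ht₀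
      obtain ⟨p, hp⟩ := hφ f (g x)
      refine ⟨p, ?_, fun t ht ↦ (hp t).symm.trans (hfW ht)⟩
      rintro rfl
      exact hf ((hp t₀).trans Polynomial.eval_zero)
    choose! p hp0 hp using key
    have hprod : ∏ i ∈ insert a s, p i ≠ 0 := Finset.prod_ne_zero_iff.mpr hp0
    obtain ⟨t, ht⟩ : ∃ t, (∏ i ∈ insert a s, p i).eval t ≠ 0 := by
      by_contra! h
      exact hprod (Polynomial.funext fun t ↦ by simpa using h t)
    rw [Polynomial.eval_prod, Finset.prod_ne_zero_iff] at ht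
    exact ⟨g.trans (φ t), fun i hi hmem ↦ ht i hi (hp i hi t hmem)⟩

end

section Transport

variable {R L : Type*} [CommRing R] [LieRing L] [LieAlgebra R L]

lemma LieSubalgebra.IsCartanSubalgebra.map_lieEquiv {H : LieSubalgebra R L}
    (hH : H.IsCartanSubalgebra) (e : L ≃ₗ⁅R⁆ L) :
    (H.map (e : L →ₗ⁅R⁆ L)).IsCartanSubalgebra where
  nilpotent := (e.lieSubalgebraMap H).nilpotent_iff_equiv_nilpotent.mp hH.nilpotent
  self_normalizing := by
    refine le_antisymm (fun z hz ↦ ?_) (le_normalizer _)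
    refine ⟨e.symm z, ?_, e.apply_symm_apply z⟩
    have : e.symm z ∈ H.normalizer := by
      refine (mem_normalizer_iff H _).mpr fun y hy ↦ ?_
      obtain ⟨w, hw, hwe⟩ := (mem_normalizer_iff _ z).mp hz (e y) ⟨y, hy, rfl⟩
      have hw' : e w = ⁅z, e y⁆ := hwe
      have : ⁅e.symm z, y⁆ = w := e.injective (by simp [hw'])
      rw [this]
      exact hw
    rwa [hH.self_normalizing] at this

lemma LieAlgebra.symm_apply_mem_rootSpace_comp (H : LieSubalgebra R L) [LieRing.IsNilpotent H]
    (e : L ≃ₗ⁅R⁆ L) [LieRing.IsNilpotent (H.map (e : L →ₗ⁅R⁆ L))]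
    (χ : H.map (e : L →ₗ⁅R⁆ L) → R) {y : L} (hy : y ∈ rootSpace (H.map (e : L →ₗ⁅R⁆ L)) χ) :
    e.symm y ∈ rootSpace H (χ ∘ e.lieSubalgebraMap H) := by
  rw [LieModule.mem_genWeightSpace] at hy ⊢
  intro h
  obtain ⟨k, hk⟩ := hy (e.lieSubalgebraMap H h)
  refine ⟨k, ?_⟩
  have hpow (m : ℕ) (z : L) :
      ((LieModule.toEnd R H L h - (χ ∘ e.lieSubalgebraMap H) h • 1) ^ m) (e.symm z) =
        e.symm (((LieModule.toEnd R _ L (e.lieSubalgebraMap H h) -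
          χ (e.lieSubalgebraMap H h) • 1) ^ m) z) := by
    induction m generalizing z with
    | zero => simp
    | succ m ih =>
      rw [pow_succ, pow_succ, Module.End.mul_apply, Module.End.mul_apply, ← ih]
      congr 1
      apply e.injective
      have (u v : L) : e ⁅u, v⁆ = ⁅e u, e v⁆ := (e : L →ₗ⁅R⁆ L).map_lie u v
      simp [LieSubalgebra.coe_bracket_of_module, this]
  rw [hpow, hk, map_zero]

end Transport

lemma LieAlgebra.cartan_sup_biSup_rootSpace_ne_top
    {K L : Type*} [Field K] [LieRing L] [LieAlgebra K L] [FiniteDimensional K L]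
    (H : LieSubalgebra K L) [H.IsCartanSubalgebra] {α : Module.Dual K H} (h0 : α ≠ 0)
    (hα : rootSpace H α ≠ ⊥) :
    H.toSubmodule ⊔ ⨆ β ∈ {β : Module.Dual K H | β ≠ 0 ∧ rootSpace H β ≠ ⊥ ∧ β ≠ α},
      (rootSpace H β : Submodule K L) ≠ ⊤ := by
  intro htop
  have hind := (LieSubmodule.iSupIndep_toSubmodule.mpr <|
    LieModule.iSupIndep_genWeightSpace K H L) α
  have hle : H.toSubmodule ⊔ ⨆ β ∈ {β : Module.Dual K H | β ≠ 0 ∧ rootSpace H β ≠ ⊥ ∧ β ≠ α},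
      (rootSpace H β : Submodule K L) ≤
      ⨆ χ : H → K, ⨆ (_ : χ ≠ α), (rootSpace H χ : Submodule K L) := by
    refine sup_le ?_ (iSup₂_le fun β hβ ↦ ?_)
    · have hH : (rootSpace H (0 : H → K)).toSubmodule = H.toSubmodule := by
        rw [rootSpace_zero_eq]; rfl
      rw [← hH]
      exact le_iSup₂_of_le (0 : H → K) (fun h ↦ h0 (DFunLike.coe_injective h.symm)) le_rfl
    · exact le_iSup₂_of_le (β : H → K) (fun h ↦ hβ.2.2 (DFunLike.coe_injective h)) le_rfl
  rw [htop, top_le_iff] at hle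
  rw [hle, disjoint_top] at hind
  exact hα (by simpa using hind)

/-- Let `𝔤` be a finite-dimensional simple Lie algebra over an
algebraically closed field `K` of characteristic zero and let `x ≠ 0`.  Then there is a
Cartan subalgebra `H` of `𝔤` such that `x` is `H`-balanced: for every nonzero root `α`
of `𝔤` relative to `H` (i.e. `α ∈ 𝔥*` with `α ≠ 0` and root space `𝔤^α ≠ ⊥`), the
element `x` does not lie in the sum of `H` and the root spaces `𝔤^β` over all nonzero
roots `β ≠ α` — equivalently, the component of `x` in `𝔤^α` is nonzero. -/
theorem exists_isCartanSubalgebra_balanced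
    {K 𝔤 : Type*} [Field K] [IsAlgClosed K] [CharZero K]
    [LieRing 𝔤] [LieAlgebra K 𝔤] [FiniteDimensional K 𝔤] [LieAlgebra.IsSimple K 𝔤]
    (x : 𝔤) (hx : x ≠ 0) :
    ∃ (H : LieSubalgebra K 𝔤) (_ : H.IsCartanSubalgebra),
      ∀ α : Module.Dual K H, α ≠ 0 → rootSpace H (⇑α) ≠ ⊥ →
        x ∉ (H.toSubmodule ⊔
          ⨆ β ∈ {β : Module.Dual K H | β ≠ 0 ∧ rootSpace H (⇑β) ≠ ⊥ ∧ β ≠ α},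
            (rootSpace H (⇑β) : Submodule K 𝔤)) := by
  obtain ⟨a, ha⟩ := exists_isCartanSubalgebra_engel K 𝔤
  set H := LieSubalgebra.engel K a
  have hfin : {α : Module.Dual K H | α ≠ 0 ∧ rootSpace H α ≠ ⊥}.Finite :=
    ((LieModule.finite_genWeightSpace_ne_bot K H 𝔤).preimage
      (DFunLike.coe_injective (F := Module.Dual K H)).injOn).subset fun α hα ↦ hα.2
  obtain ⟨g, hg⟩ := exists_lieEquiv_forall_apply_notMem hfin.toFinset
    (fun α : Module.Dual K H ↦ H.toSubmodule ⊔
      ⨆ β ∈ {β : Module.Dual K H | β ≠ 0 ∧ rootSpace H β ≠ ⊥ ∧ β ≠ α},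
        (rootSpace H β : Submodule K 𝔤))
    (fun α hα ↦ by
      rw [Set.Finite.mem_toFinset] at hα
      exact cartan_sup_biSup_rootSpace_ne_top H hα.1 hα.2) hx
  let e := g.symm
  have hcartan := ha.map_lieEquiv e
  let r : H →ₗ[K] (H.map (e : 𝔤 →ₗ⁅K⁆ 𝔤)) := (e.lieSubalgebraMap H).toLinearEquiv
  have hr : Function.Injective fun β : Module.Dual K _ ↦ β.comp r := fun β β' h ↦ by
    ext y
    obtain ⟨z, rfl⟩ := (e.lieSubalgebraMap H).surjective y
    exact LinearMap.congr_fun h z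
  have hmem (β : Module.Dual K (H.map (e : 𝔤 →ₗ⁅K⁆ 𝔤))) {y : 𝔤} (hy : y ∈ rootSpace _ β) :
      g y ∈ rootSpace H (β.comp r) := symm_apply_mem_rootSpace_comp H e β hy
  have hroot (β : Module.Dual K (H.map (e : 𝔤 →ₗ⁅K⁆ 𝔤))) (h0 : β ≠ 0)
      (hβ : rootSpace _ β ≠ ⊥) : β.comp r ≠ 0 ∧ rootSpace H (β.comp r) ≠ ⊥ := by
    refine ⟨fun h ↦ h0 (hr (by simpa using h)), fun h ↦ hβ ?_⟩
    refine (LieSubmodule.eq_bot_iff _).mpr fun y hy ↦ ?_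
    have := hmem β hy
    rw [h, LieSubmodule.mem_bot] at this
    simpa using this
  refine ⟨H.map (e : 𝔤 →ₗ⁅K⁆ 𝔤), hcartan, fun α h0 hα hxα ↦ ?_⟩
  refine hg (α.comp r) (hfin.mem_toFinset.mpr (hroot α h0 hα)) ?_
  suffices h : _ ≤ (H.toSubmodule ⊔ ⨆ β ∈ {β : Module.Dual K H | β ≠ 0 ∧ rootSpace H β ≠ ⊥ ∧
      β ≠ α.comp r}, (rootSpace H β : Submodule K 𝔤)).comap (g : 𝔤 →ₗ⁅K⁆ 𝔤).toLinearMap from h hxα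
  refine sup_le ?_ (iSup₂_le fun β hβ ↦ ?_)
  · rintro _ ⟨z, hz, rfl⟩
    refine Submodule.mem_sup_left ?_
    have : g (e z) = z := g.apply_symm_apply z
    simpa [this] using hz
  · intro y hy
    refine Submodule.mem_sup_right (Submodule.mem_iSup_of_mem (β.comp r)
      (Submodule.mem_iSup_of_mem ⟨(hroot β hβ.1 hβ.2.1).1, (hroot β hβ.1 hβ.2.1).2,
        fun h ↦ hβ.2.2 (hr h)⟩ (hmem β hy)))
end
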